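/- (Exactness of row-subsampled ID.) Let A be a real m × n matrix, let J ⊆ {0, …, m−1} be a set of row indices, and set B = A(J,:). Suppose rank(B) = rank(A). Let I ⊆ {0, …, n−1} and let C be a real |I| × n matrix such that B = B(:,I) C exactly. Then A = A(:,I) C. -/

import Mathlib

open Matrix

/-- The submatrix of `A` formed by the columns indexed by the set `I`, in increasing order. -/
noncomputable def colSub {m n : ℕ} (A : Matrix (Fin m) (Fin n) ℝ) (I : Finset (Fin n)) :
    Matrix (Fin m) (Fin I.card) ℝ :=
  A.submatrix id fun j => ((I.orderIsoOfFin rfl j : Fin n))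

/-- The submatrix of `A` formed by the rows indexed by the set `J`, in increasing order. -/
noncomputable def rowSub {m n : ℕ} (A : Matrix (Fin m) (Fin n) ℝ) (J : Finset (Fin m)) :
    Matrix (Fin J.card) (Fin n) ℝ :=
  A.submatrix (fun i => ((J.orderIsoOfFin rfl i : Fin m))) id

/-- A row selection that preserves the rank preserves the kernel. -/
theorem ker_mulVecLin_submatrix_of_rank_eq {K l m n : Type*} [Field K] [Fintype n]
    (A : Matrix m n K) (r : l → m) (h : (A.submatrix r id).rank = A.rank) :
    LinearMap.ker (A.submatrix r id).mulVecLin = LinearMap.ker A.mulVecLin := by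
  symm
  apply Submodule.eq_of_le_of_finrank_eq
  · intro v hv
    simp only [LinearMap.mem_ker, mulVecLin_apply] at hv ⊢
    ext i
    exact congrFun hv (r i)
  · have hA := LinearMap.finrank_range_add_finrank_ker A.mulVecLin
    have hB := LinearMap.finrank_range_add_finrank_ker (A.submatrix r id).mulVecLin
    unfold Matrix.rank at h
    omega

/-- A row selection that preserves the rank reflects equality of products. -/
theorem mul_eq_mul_of_submatrix_mul_eq {K l m n p : Type*} [Field K] [Fintype n]
    (A : Matrix m n K) (r : l → m) (h : (A.submatrix r id).rank = A.rank)
    {X Y : Matrix n p K} (hXY : A.submatrix r id * X = A.submatrix r id * Y) :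
    A * X = A * Y := by
  ext i j
  have hker : X.col j - Y.col j ∈ LinearMap.ker A.mulVecLin := by
    rw [← ker_mulVecLin_submatrix_of_rank_eq A r h, LinearMap.mem_ker, mulVecLin_apply,
      mulVec_sub, sub_eq_zero]
    ext k
    exact congrFun (congrFun hXY k) j
  rw [LinearMap.mem_ker, mulVecLin_apply, mulVec_sub, sub_eq_zero] at hker
  exact congrFun hker i

/-- Column selection is right multiplication by the selected columns of the identity. -/
theorem colSub_eq_mul {m n : ℕ} (A : Matrix (Fin m) (Fin n) ℝ) (I : Finset (Fin n)) :
    colSub A I = A * colSub (1 : Matrix (Fin n) (Fin n) ℝ) I := by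
  ext i j
  simp [colSub, Matrix.mul_apply, Matrix.one_apply]

/-- Exactness of the row-subsampled ID: if `B = A(J,:)` has the same rank as `A` and
`B = B(:,I) C` exactly, then `A = A(:,I) C`. -/
theorem stmt9 (m n : ℕ) (A : Matrix (Fin m) (Fin n) ℝ) (J : Finset (Fin m))
    (B : Matrix (Fin J.card) (Fin n) ℝ) (hB : B = rowSub A J)
    (hrank : B.rank = A.rank)
    (I : Finset (Fin n)) (C : Matrix (Fin I.card) (Fin n) ℝ)
    (hID : B = colSub B I * C) :
    A = colSub A I * C := by
  subst hB
  rw [colSub_eq_mul, Matrix.mul_assoc]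
  rw [colSub_eq_mul, Matrix.mul_assoc] at hID
  simpa only [Matrix.mul_one] using
    mul_eq_mul_of_submatrix_mul_eq A _ hrank (X := 1) ((Matrix.mul_one _).trans hID)
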